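/- Let v : ℝ → ℝ be continuous and set z(t) = ∫₀ᵗ v(s) ds. Let K₀ : ℝ → ℝ be continuously differentiable, let a : ℝ → ℝ be continuous, and let Φ : ℝ × ℝ → ℝ be continuously differentiable. Define K : ℝ × ℝ → ℝ by K(t,x) = K₀(x + z(t)) + ∫₀ᵗ a(s)·Φ(s, x + z(t) − z(s)) ds. Then K(0,x) = K₀(x) for all x, and K satisfies the transport equation with source: ∂ₜK(t,x) − v(t)·∂ₓK(t,x) = a(t)·Φ(t,x) for all (t,x). -/

import Mathlib

open Topology in
/-- Leibniz rule for a jointly continuous integrand with jointly continuous partial derivative. -/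
theorem bathtub_leibniz (f g : ℝ → ℝ → ℝ) (hf : Continuous f.uncurry) (hg : Continuous g.uncurry)
    (hfg : ∀ y s, HasDerivAt (fun y => f y s) (g y s) y) (t y₀ : ℝ) :
    HasDerivAt (fun y => ∫ s in (0:ℝ)..t, f y s) (∫ s in (0:ℝ)..t, g y₀ s) y₀ := by
  have hfc : ∀ y, Continuous (f y) := fun y => hf.comp (by fun_prop : Continuous fun s => (y, s))
  have hgc : ∀ y, Continuous (g y) := fun y => hg.comp (by fun_prop : Continuous fun s => (y, s))
  obtain ⟨C, hC⟩ := ((isCompact_closedBall y₀ 1).prod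
    (isCompact_uIcc (a := (0:ℝ)) (b := t))).exists_bound_of_continuousOn hg.continuousOn
  refine (intervalIntegral.hasDerivAt_integral_of_dominated_loc_of_deriv_le
    (F := f) (F' := g) (bound := fun _ => C)
    (Metric.closedBall_mem_nhds y₀ one_pos) ?_ ?_ ?_ ?_ ?_ ?_).2
  · exact Filter.Eventually.of_forall fun y => (hfc y).aestronglyMeasurable
  · exact (hfc y₀).intervalIntegrable _ _
  · exact (hgc y₀).aestronglyMeasurable
  · exact Filter.Eventually.of_forall fun s hs y hy =>
      hC (y, s) ⟨hy, Set.uIoc_subset_uIcc hs⟩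
  · exact intervalIntegrable_const
  · exact Filter.Eventually.of_forall fun s _ y _ => hfg y s

/-- Joint differentiability of the parametric primitive. -/
theorem bathtub_joint (f g : ℝ → ℝ → ℝ) (hf : Continuous f.uncurry) (hg : Continuous g.uncurry)
    (hfg : ∀ y s, HasDerivAt (fun y => f y s) (g y s) y) (t y : ℝ) :
    HasFDerivAt (fun p : ℝ × ℝ => ∫ s in (0:ℝ)..p.1, f p.2 s)
      ((ContinuousLinearMap.toSpanSingleton ℝ (f y t)).coprod
        (ContinuousLinearMap.toSpanSingleton ℝ (∫ s in (0:ℝ)..t, g y s))) (t, y) := by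
  have hfc : ∀ y, Continuous (f y) := fun y => hf.comp (by fun_prop : Continuous fun s => (y, s))
  have hc : Continuous fun c : ℝ => ContinuousLinearMap.toSpanSingleton ℝ c :=
    (ContinuousLinearMap.toSpanSingletonCLE (𝕜 := ℝ) (E := ℝ)).continuous
  refine (hasStrictFDerivAt_uncurry_coprod (𝕜 := ℝ) (u := ((t, y) : ℝ × ℝ))
    (f := fun t y => ∫ s in (0:ℝ)..t, f y s)
    (f₁ := fun t y => ContinuousLinearMap.toSpanSingleton ℝ (f y t))
    (f₂ := fun t y => ContinuousLinearMap.toSpanSingleton ℝ (∫ s in (0:ℝ)..t, g y s))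
    ?_ ?_ ?_ ?_).hasFDerivAt
  · exact Filter.Eventually.of_forall fun p =>
      ((hfc p.2).integral_hasStrictDerivAt 0 p.1).hasDerivAt.hasFDerivAt
  · exact Filter.Eventually.of_forall fun p => (bathtub_leibniz f g hf hg hfg p.1 p.2).hasFDerivAt
  · exact (hc.comp (hf.comp continuous_swap)).continuousAt
  · refine (hc.comp (?_ : Continuous fun p : ℝ × ℝ => ∫ s in (0:ℝ)..p.1, g p.2 s)).continuousAt
    refine intervalIntegral.continuous_parametric_intervalIntegral_of_continuous
      (f := fun (p : ℝ × ℝ) s => g p.2 s) ?_ continuous_fst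
    exact hg.comp (by fun_prop : Continuous fun q : (ℝ × ℝ) × ℝ => (q.1.2, q.2))


open intervalIntegral in
/-- The explicit formula
`K (t, x) = K₀ (x + z t) + ∫₀ᵗ a s · Φ (s, x + z t − z s) ds`, with
`z t = ∫₀ᵗ v`, solves the transport equation with source
`∂ₜK − v t · ∂ₓK = a t · Φ (t, x)` and has initial data `K (0, ·) = K₀`. -/
theorem bathtub_explicit_solution
    (v : ℝ → ℝ) (hv : Continuous v)
    (z : ℝ → ℝ) (hz : ∀ t, z t = ∫ s in (0:ℝ)..t, v s)
    (K₀ : ℝ → ℝ) (hK₀ : ContDiff ℝ 1 K₀)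
    (a : ℝ → ℝ) (ha : Continuous a)
    (Φ : ℝ × ℝ → ℝ) (hΦ : ContDiff ℝ 1 Φ)
    (K : ℝ → ℝ → ℝ)
    (hK : ∀ t x, K t x = K₀ (x + z t) + ∫ s in (0:ℝ)..t, a s * Φ (s, x + z t - z s)) :
    (∀ x, K 0 x = K₀ x) ∧
    (∀ t x, DifferentiableAt ℝ (fun y => K t y) x ∧
      HasDerivAt (fun s => K s x)
        (v t * deriv (fun y => K t y) x + a t * Φ (t, x)) t) := by
  have hzd : ∀ t, HasDerivAt z (v t) t := by
    intro t
    rw [funext hz]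
    exact (hv.integral_hasStrictDerivAt 0 t).hasDerivAt
  have hzc : Continuous z := continuous_iff_continuousAt.2 fun t => (hzd t).continuousAt
  have hz0 : z 0 = 0 := by simp [hz]
  set f : ℝ → ℝ → ℝ := fun y s => a s * Φ (s, y - z s) with hf
  set g : ℝ → ℝ → ℝ := fun y s => a s * fderiv ℝ Φ (s, y - z s) (0, 1) with hg
  have hΦc := hΦ.continuous
  have hΦ' : Continuous (fderiv ℝ Φ) := hΦ.continuous_fderiv (by norm_num)
  have hfc : Continuous f.uncurry := by
    change Continuous fun p : ℝ × ℝ => a p.2 * Φ (p.2, p.1 - z p.2)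
    fun_prop
  have hgc : Continuous g.uncurry := by
    change Continuous fun p : ℝ × ℝ => a p.2 * fderiv ℝ Φ (p.2, p.1 - z p.2) (0, 1)
    fun_prop
  have hfg : ∀ y s, HasDerivAt (fun y => f y s) (g y s) y := by
    intro y s
    have h1 : HasDerivAt (fun y : ℝ => (s, y - z s)) ((0 : ℝ), (1 : ℝ)) y :=
      (hasDerivAt_const y s).prodMk ((hasDerivAt_id y).sub_const (z s))
    exact (((hΦ.differentiable (by norm_num)) (s, y - z s)).hasFDerivAt.comp_hasDerivAt y
      h1).const_mul (a s)
  have hK0d : ∀ y, HasDerivAt K₀ (deriv K₀ y) y := fun y =>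
    ((hK₀.differentiable (by norm_num)) y).hasDerivAt
  refine ⟨fun x => by simp [hK, hz0], fun t x => ?_⟩
  have hx : HasDerivAt (fun y => K t y)
      (deriv K₀ (x + z t) + ∫ s in (0:ℝ)..t, g (x + z t) s) x := by
    rw [show (fun y => K t y) = fun y => K₀ (y + z t) + ∫ s in (0:ℝ)..t, f (y + z t) s from
      funext fun y => hK t y]
    exact (hK0d _).comp_add_const x (z t) |>.add
      ((bathtub_leibniz f g hfc hgc hfg t (x + z t)).comp_add_const x (z t))
  refine ⟨hx.differentiableAt, ?_⟩
  rw [hx.deriv]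
  have hxz : HasDerivAt (fun s => x + z s) (v t) t := (hzd t).const_add x
  have h1 : HasDerivAt (fun s => (s, x + z s)) ((1 : ℝ), v t) t := (hasDerivAt_id t).prodMk hxz
  have h2 := (bathtub_joint f g hfc hgc hfg t (x + z t)).comp_hasDerivAt t h1
  have h3 := ((hK0d (x + z t)).comp t hxz).add h2
  rw [show (fun s => K s x) = fun r => K₀ (x + z r) + ∫ s in (0:ℝ)..r, f (x + z r) s from
      funext fun r => hK r x]
  refine HasDerivAt.congr_deriv h3 ?_
  simp [hf]
  ring
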